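/- Let k' be a field of characteristic 0, R = k'[[s]], and K = k'((s)). For i = 1, 2, 3 let aᵢ ∈ ℤ and let ũᵢ, ûᵢ be units of R[t]/(t³) with s^{aᵢ}·ũᵢ ≡ s^{aᵢ}·ûᵢ mod t²; set ỹᵢ := s^{aᵢ}·ũᵢ and ŷᵢ := s^{aᵢ}·ûᵢ, units of K[t]/(t³). Then s·Ω((ỹ₁, ỹ₂, ỹ₃), (ŷ₁, ŷ₂, ŷ₃)) lies in k'[[s]]; that is, Ω has at most a simple (logarithmic) pole at s = 0. If moreover a₁ = a₂ = a₃ = 0, i.e. all entries are units of R[t]/(t³), then Ω((ỹ₁, ỹ₂, ỹ₃), (ŷ₁, ŷ₂, ŷ₃)) ∈ k'[[s]] and its residue at s = 0 is 0. -/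

import Mathlib

noncomputable section

/-- The formal derivative `d/ds` on the field of Laurent series `k'((s))`. -/
def lsDeriv {k' : Type*} [Field k'] (f : LaurentSeries k') : LaurentSeries k' where
  coeff n := (n + 1 : ℤ) • f.coeff (n + 1)
  isPWO_support' := by
    refine Set.IsPWO.mono (Set.IsPWO.image_of_monotoneOn (f.isPWO_support)
      (fun x _ y _ h => by simpa using h : MonotoneOn (fun m : ℤ => m - 1) f.support)) ?_
    intro n hn
    refine ⟨n + 1, ?_, by ring⟩
    simp only [Function.mem_support, ne_eq] at hn ⊢
    intro h
    exact hn (by simp [HahnSeries.support, h] at hn ⊢)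

/-- The truncated polynomial ring `K[t]/(t³)`. -/
abbrev T3 (K : Type*) [Field K] := Polynomial K ⧸ Ideal.span {(Polynomial.X : Polynomial K) ^ 3}

/-- The class of `t` in `K[t]/(t³)`. -/
def tE (K : Type*) [Field K] : T3 K := Ideal.Quotient.mk _ Polynomial.X

/-- The constant `x` viewed in `K[t]/(t³)`. -/
def cE {K : Type*} [Field K] (x : K) : T3 K := algebraMap K (T3 K) x

/-- The truncated exponential `exp(u) = 1 + u + u²/2` on `K[t]/(t³)`, well defined in
characteristic zero for `u` in the ideal `(t)`. -/
def expE {K : Type*} [Field K] (u : T3 K) : T3 K := 1 + u + cE (2⁻¹ : K) * u ^ 2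

/-- The element `α₀ · exp(α₁ t + α₂ t²)` of `K[t]/(t³)`; every unit of `K[t]/(t³)` has a
unique such exponential decomposition with `α₀ ∈ K^×`, `α₁, α₂ ∈ K`. -/
def unitE {K : Type*} [Field K] (α₀ α₁ α₂ : K) : T3 K :=
  cE α₀ * expE (cE α₁ * tE K + cE α₂ * tE K ^ 2)

/-- The canonical expression `Ω(p̃, p̂) ∈ K` of the paper (the canonical 1-form is
`Ω(p̃,p̂)·ds`), evaluated via the exponential parameters `(a0 i, a1 i, x2 i)` of the entries
of `p̃` and `(a0 i, a1 i, y2 i)` of the entries of `p̂` (congruent mod `t²`, so the parameters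
`a0`, `a1` are shared); `D` is the derivative of `K`:
`Ω(p̃, p̂) = Σ_{σ∈S₃} sgn(σ)·a1(σ1)·(x2(σ3) − y2(σ3))·(D(a0(σ2))/a0(σ2))`. -/
def Omega {K : Type*} [Field K] (D : K → K) (a0 a1 x2 y2 : Fin 3 → K) : K :=
  ∑ σ : Equiv.Perm (Fin 3),
    (Equiv.Perm.sign σ : ℤ) •
      (a1 (σ 0) * ((x2 (σ 2) - y2 (σ 2)) * (D (a0 (σ 1)) / a0 (σ 1))))

open HahnSeries in
/-- The derivative of `s ^ a * f` for a power series `f`. -/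
theorem lsDeriv_zpow_mul {k : Type*} [Field k] (a : ℤ) (f : PowerSeries k) :
    lsDeriv (ofPowerSeries ℤ k PowerSeries.X ^ a * ofPowerSeries ℤ k f)
      = (a : LaurentSeries k) * ofPowerSeries ℤ k PowerSeries.X ^ (a - 1) * ofPowerSeries ℤ k f
        + ofPowerSeries ℤ k PowerSeries.X ^ a
          * ofPowerSeries ℤ k (PowerSeries.derivative k f) := by
  ext n
  have hder : (ofPowerSeries ℤ k (PowerSeries.derivative k f)).coeff (n - a)
      = ((n - a + 1 : ℤ) : k) * (ofPowerSeries ℤ k f).coeff (n - a + 1) := by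
    generalize n - a = m
    rcases lt_or_ge m 0 with hm | hm
    · rcases (show m + 1 < 0 ∨ m + 1 = 0 by omega) with h | h
      · simp [PowerSeries.coeff_coe, hm, h]
      · simp [PowerSeries.coeff_coe, hm, h]
    · lift m to ℕ using hm
      rw [ofPowerSeries_apply_coeff, PowerSeries.coeff_derivative,
        show (m : ℤ) + 1 = ((m + 1 : ℕ) : ℤ) by push_cast; rfl, ofPowerSeries_apply_coeff]
      push_cast
      ring
  rw [mul_assoc, ← zsmul_eq_mul]
  simp only [lsDeriv, ofPowerSeries_X, ← RatFunc.single_zpow, coeff_add, coeff_smul,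
    coeff_single_mul, one_mul, hder]
  rw [show n + 1 - a = n - a + 1 by ring, show n - (a - 1) = n - a + 1 by ring]
  simp only [zsmul_eq_mul]
  push_cast
  ring

/-- The logarithmic derivative of `s ^ a * f` for an invertible power series `f`. -/
theorem lsDeriv_div_self {k : Type*} [Field k] (a : ℤ) {f : PowerSeries k} (hf : IsUnit f) :
    lsDeriv (HahnSeries.ofPowerSeries ℤ k PowerSeries.X ^ a * HahnSeries.ofPowerSeries ℤ k f)
        / (HahnSeries.ofPowerSeries ℤ k PowerSeries.X ^ a * HahnSeries.ofPowerSeries ℤ k f)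
      = a * (HahnSeries.ofPowerSeries ℤ k PowerSeries.X)⁻¹
        + HahnSeries.ofPowerSeries ℤ k (PowerSeries.derivative k f)
          / HahnSeries.ofPowerSeries ℤ k f := by
  have hX : HahnSeries.ofPowerSeries ℤ k PowerSeries.X ≠ 0 := by simp
  have hf' : HahnSeries.ofPowerSeries ℤ k f ≠ 0 := (hf.map _).ne_zero
  rw [lsDeriv_zpow_mul, zpow_sub_one₀ hX]
  field_simp

/-- The quotient of a power series by an invertible one is a power series. -/
theorem ofPowerSeries_div_mem_range {k : Type*} [Field k] (g : PowerSeries k) {f : PowerSeries k}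
    (hf : IsUnit f) :
    HahnSeries.ofPowerSeries ℤ k g / HahnSeries.ofPowerSeries ℤ k f
      ∈ (HahnSeries.ofPowerSeries ℤ k).range := by
  obtain ⟨v, rfl⟩ := hf
  refine ⟨g * ↑v⁻¹, ?_⟩
  rw [eq_div_iff (v.isUnit.map _).ne_zero, ← map_mul, mul_assoc, Units.inv_mul, mul_one]

theorem tE_pow_three (K : Type*) [Field K] : tE K ^ 3 = 0 := by
  rw [tE, ← map_pow, Ideal.Quotient.eq_zero_iff_mem]
  exact Ideal.mem_span_singleton_self _

/-- The elements `1, t, t²` of `K[t]/(t³)` are linearly independent. -/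
theorem cE_quadratic_injective {K : Type*} [Field K] {a b c a' b' c' : K}
    (h : cE a + cE b * tE K + cE c * tE K ^ 2 = cE a' + cE b' * tE K + cE c' * tE K ^ 2) :
    a = a' ∧ b = b' ∧ c = c' := by
  have hmk (x y z : K) : cE x + cE y * tE K + cE z * tE K ^ 2
      = Ideal.Quotient.mk (Ideal.span {(Polynomial.X : Polynomial K) ^ 3})
        (Polynomial.C x + Polynomial.C y * Polynomial.X + Polynomial.C z * Polynomial.X ^ 2) := by
    simp only [map_add, map_mul, map_pow]
    rfl
  rw [hmk, hmk, Ideal.Quotient.eq, Ideal.mem_span_singleton, Polynomial.X_pow_dvd_iff] at h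
  have h0 := h 0 (by norm_num)
  have h1 := h 1 (by norm_num)
  have h2 := h 2 (by norm_num)
  simp [Polynomial.coeff_X, Polynomial.coeff_C, Polynomial.coeff_X_pow] at h0 h1 h2
  exact ⟨sub_eq_zero.mp h0, sub_eq_zero.mp h1, sub_eq_zero.mp h2⟩

theorem unitE_eq {K : Type*} [Field K] (a b c : K) :
    unitE a b c = cE a + cE (a * b) * tE K + cE (a * (c + 2⁻¹ * b ^ 2)) * tE K ^ 2 := by
  simp only [unitE, expE, cE, map_mul, map_add, map_pow]
  linear_combination (algebraMap K (T3 K) a * algebraMap K (T3 K) 2⁻¹ * algebraMap K (T3 K) c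
    * (2 * algebraMap K (T3 K) b + algebraMap K (T3 K) c * tE K)) * tE_pow_three K

/-- Exponential parameters in terms of the coefficients of the decomposed element. -/
theorem eq_of_eq_unitE {K : Type*} [Field K] {x a b c α₀ α₁ α₂ : K} (hα₀ : α₀ ≠ 0)
    (h : cE x * (cE a + cE b * tE K + cE c * tE K ^ 2) = unitE α₀ α₁ α₂) :
    α₀ = x * a ∧ α₁ = b / a ∧ α₂ = c / a - 2⁻¹ * (b / a) ^ 2 := by
  have h' : cE (x * a) + cE (x * b) * tE K + cE (x * c) * tE K ^ 2 = unitE α₀ α₁ α₂ := by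
    rw [← h]
    simp only [cE, map_mul]
    ring
  rw [unitE_eq] at h'
  obtain ⟨h0, h1, h2⟩ := cE_quadratic_injective h'
  subst h0
  have hx : x ≠ 0 := left_ne_zero_of_mul hα₀
  have ha : a ≠ 0 := right_ne_zero_of_mul hα₀
  have hb : b = a * α₁ := mul_left_cancel₀ hx (by rw [h1]; ring)
  have hc : c = a * (α₂ + 2⁻¹ * α₁ ^ 2) := mul_left_cancel₀ hx (by rw [h2]; ring)
  subst hb hc
  simp only [mul_div_cancel_left₀ _ ha]
  exact ⟨trivial, trivial, by ring⟩

theorem mul_Omega {K : Type*} [Field K] (x : K) (D : K → K) (a0 a1 x2 y2 : Fin 3 → K) :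
    x * Omega D a0 a1 x2 y2 = Omega (fun f => x * D f) a0 a1 x2 y2 := by
  simp only [Omega, Finset.mul_sum, zsmul_eq_mul]
  refine Finset.sum_congr rfl fun _ _ => ?_
  ring

theorem Omega_mem {K : Type*} [Field K] (S : Subring K) {D : K → K} {a0 a1 x2 y2 : Fin 3 → K}
    (hD : ∀ i, D (a0 i) / a0 i ∈ S) (h1 : ∀ i, a1 i ∈ S) (hx : ∀ i, x2 i ∈ S)
    (hy : ∀ i, y2 i ∈ S) : Omega D a0 a1 x2 y2 ∈ S :=
  S.sum_mem fun _ _ => S.zsmul_mem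
    (S.mul_mem (h1 _) (S.mul_mem (S.sub_mem (hx _) (hy _)) (hD _))) _

/-- Let `k'` be a field of characteristic `0`, `R = k'[[s]]`, and
`K = k'((s))`.  For `i = 1, 2, 3` let `aᵢ ∈ ℤ` and let `ũᵢ = u0ᵢ + u1ᵢ·t + tu2ᵢ·t²`,
`ûᵢ = u0ᵢ + u1ᵢ·t + hu2ᵢ·t²` be units of `R[t]/(t³)` (i.e. `u0ᵢ ∈ R^×`) with
`s^{aᵢ}·ũᵢ ≡ s^{aᵢ}·ûᵢ mod t²` (encoded by the shared coefficients `u0ᵢ, u1ᵢ`); set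
`ỹᵢ := s^{aᵢ}·ũᵢ` and `ŷᵢ := s^{aᵢ}·ûᵢ`, units of `K[t]/(t³)`, with exponential
parameters `(A0 i, A1 i, TA2 i)` resp. `(A0 i, A1 i, HA2 i)`.  Then
`s·Ω((ỹ₁,ỹ₂,ỹ₃), (ŷ₁,ŷ₂,ŷ₃))` lies in `k'[[s]]`; that is, `Ω` has at most a simple
(logarithmic) pole at `s = 0`.  If moreover `a₁ = a₂ = a₃ = 0`, i.e. all entries are units
of `R[t]/(t³)`, then `Ω((ỹ₁,ỹ₂,ỹ₃), (ŷ₁,ŷ₂,ŷ₃)) ∈ k'[[s]]` and its residue at `s = 0`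
is `0`. -/
theorem statement_8 {k' : Type*} [Field k'] [CharZero k']
    (aexp : Fin 3 → ℤ) (u0 u1 tu2 hu2 : Fin 3 → PowerSeries k')
    (hunit : ∀ i, IsUnit (u0 i))
    (A0 A1 TA2 HA2 : Fin 3 → LaurentSeries k') (hA0 : ∀ i, A0 i ≠ 0)
    (hdect : ∀ i,
      cE ((HahnSeries.ofPowerSeries ℤ k' PowerSeries.X) ^ aexp i)
          * (cE (HahnSeries.ofPowerSeries ℤ k' (u0 i))
            + cE (HahnSeries.ofPowerSeries ℤ k' (u1 i)) * tE (LaurentSeries k')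
            + cE (HahnSeries.ofPowerSeries ℤ k' (tu2 i)) * tE (LaurentSeries k') ^ 2)
        = unitE (A0 i) (A1 i) (TA2 i))
    (hdech : ∀ i,
      cE ((HahnSeries.ofPowerSeries ℤ k' PowerSeries.X) ^ aexp i)
          * (cE (HahnSeries.ofPowerSeries ℤ k' (u0 i))
            + cE (HahnSeries.ofPowerSeries ℤ k' (u1 i)) * tE (LaurentSeries k')
            + cE (HahnSeries.ofPowerSeries ℤ k' (hu2 i)) * tE (LaurentSeries k') ^ 2)
        = unitE (A0 i) (A1 i) (HA2 i)) :
    (HahnSeries.ofPowerSeries ℤ k' PowerSeries.X) * Omega lsDeriv A0 A1 TA2 HA2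
        ∈ Set.range (HahnSeries.ofPowerSeries ℤ k')
      ∧ ((∀ i, aexp i = 0) →
          Omega lsDeriv A0 A1 TA2 HA2 ∈ Set.range (HahnSeries.ofPowerSeries ℤ k')
            ∧ (Omega lsDeriv A0 A1 TA2 HA2).coeff (-1) = 0) := by
  set S := (HahnSeries.ofPowerSeries ℤ k').range
  have hX : HahnSeries.ofPowerSeries ℤ k' PowerSeries.X ≠ 0 := by simp
  have h0 i := (eq_of_eq_unitE (hA0 i) (hdect i)).1
  have hhalf : (2⁻¹ : LaurentSeries k') ∈ S := by
    have h2 : IsUnit (2 : PowerSeries k') := by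
      rw [← map_ofNat (PowerSeries.C (R := k')) 2]
      exact (IsUnit.mk0 (2 : k') two_ne_zero).map _
    have h := ofPowerSeries_div_mem_range 1 h2
    rwa [map_one, map_ofNat, one_div] at h
  have h1 i : A1 i ∈ S := by
    rw [(eq_of_eq_unitE (hA0 i) (hdect i)).2.1]
    exact ofPowerSeries_div_mem_range _ (hunit i)
  have h2 {i : Fin 3} (w : PowerSeries k') : HahnSeries.ofPowerSeries ℤ k' w
      / HahnSeries.ofPowerSeries ℤ k' (u0 i) - 2⁻¹ * (HahnSeries.ofPowerSeries ℤ k' (u1 i)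
        / HahnSeries.ofPowerSeries ℤ k' (u0 i)) ^ 2 ∈ S :=
    S.sub_mem (ofPowerSeries_div_mem_range _ (hunit i))
      (S.mul_mem hhalf (S.pow_mem (ofPowerSeries_div_mem_range _ (hunit i)) 2))
  have hT i : TA2 i ∈ S := by
    rw [(eq_of_eq_unitE (hA0 i) (hdect i)).2.2]
    exact h2 _
  have hH i : HA2 i ∈ S := by
    rw [(eq_of_eq_unitE (hA0 i) (hdech i)).2.2]
    exact h2 _
  refine ⟨?_, fun ha => ?_⟩
  · rw [mul_Omega]
    refine Omega_mem S (fun i => ?_) h1 hT hH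
    rw [mul_div_assoc, h0, lsDeriv_div_self _ (hunit i), mul_add, mul_left_comm,
      mul_inv_cancel₀ hX, mul_one]
    exact S.add_mem (intCast_mem S _)
      (S.mul_mem ⟨_, rfl⟩ (ofPowerSeries_div_mem_range _ (hunit i)))
  · have hmem : Omega lsDeriv A0 A1 TA2 HA2 ∈ S := by
      refine Omega_mem S (fun i => ?_) h1 hT hH
      rw [h0, lsDeriv_div_self _ (hunit i), ha, Int.cast_zero, zero_mul, zero_add]
      exact ofPowerSeries_div_mem_range _ (hunit i)
    refine ⟨hmem, ?_⟩
    obtain ⟨g, hg⟩ := hmem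
    rw [← hg, PowerSeries.coeff_coe, if_pos (by norm_num)]

end
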